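/- arXiv:1604.08603 — 2 statements merged into one kernel-verified Lean document; each statement's English description precedes it below -/
import Mathlib

section
/- Let G be a cubic graph and M a set of edges of G, and let G' be the cubic graph obtained from G by attaching a co-fish to every edge of M (for each edge {u', v'} in M: subdivide {u', v'} by a new vertex, and identify that vertex with the leaf f of a new disjoint copy of the co-fish). Then (G, M) admits a marked {K_{1,3}, K_3, P_4}-decomposition if and only if G' admits a {K_{1,3}, P_4}-decomposition. -/
open SimpleGraph

variable {V : Type*}

def IsTriangleOn (G : SimpleGraph V) (u v w : V) : Prop :=
  G.Adj u v ∧ G.Adj v w ∧ G.Adj u w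

def triEdges [DecidableEq V] (u v w : V) : Finset (Sym2 V) :=
  {s(u, v), s(v, w), s(u, w)}

def IsTrianglePart [DecidableEq V] (G : SimpleGraph V) (P : Finset (Sym2 V)) : Prop :=
  ∃ u v w : V, IsTriangleOn G u v w ∧ P = triEdges u v w

def clawEdges [DecidableEq V] (c a b d : V) : Finset (Sym2 V) :=
  {s(c, a), s(c, b), s(c, d)}

def IsClawPart [DecidableEq V] (G : SimpleGraph V) (P : Finset (Sym2 V)) : Prop :=
  ∃ c a b d : V, a ≠ b ∧ a ≠ d ∧ b ≠ d ∧
    G.Adj c a ∧ G.Adj c b ∧ G.Adj c d ∧ P = clawEdges c a b d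

def p4Edges [DecidableEq V] (a b c d : V) : Finset (Sym2 V) :=
  {s(a, b), s(b, c), s(c, d)}

def IsP4On (G : SimpleGraph V) (a b c d : V) : Prop :=
  G.Adj a b ∧ G.Adj b c ∧ G.Adj c d ∧ a ≠ c ∧ a ≠ d ∧ b ≠ d

def IsP4Part [DecidableEq V] (G : SimpleGraph V) (P : Finset (Sym2 V)) : Prop :=
  ∃ a b c d : V, IsP4On G a b c d ∧ P = p4Edges a b c d

/-- `D` is a partition of the edge set of `G` into parts each satisfying `allowed`. -/
def IsDecompOn [DecidableEq V] (G : SimpleGraph V)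
    (allowed : Finset (Sym2 V) → Prop) (D : Finset (Finset (Sym2 V))) : Prop :=
  (∀ P ∈ D, allowed P) ∧
  (D : Set (Finset (Sym2 V))).PairwiseDisjoint id ∧
  ∀ e : Sym2 V, e ∈ G.edgeSet ↔ ∃ P ∈ D, e ∈ P

/-- A marked {K₁,₃, K₃, P₄}-decomposition of `(G, M)`: a partition of the edge
set into claws, triangles containing one or two marked edges, and paths P₄
whose middle edge is unmarked. -/
def IsMarkedDecompOn [DecidableEq V] (G : SimpleGraph V) (M : Set (Sym2 V))
    (D : Finset (Finset (Sym2 V))) : Prop :=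
  IsDecompOn G (fun P =>
    IsClawPart G P ∨
    (IsTrianglePart G P ∧
      (((P : Set (Sym2 V)) ∩ M).ncard = 1 ∨ ((P : Set (Sym2 V)) ∩ M).ncard = 2)) ∨
    (∃ a b c d : V, IsP4On G a b c d ∧ P = p4Edges a b c d ∧ s(b, c) ∉ M))
    D

/-- The edges of the co-fish graph on `Fin 6`, where `a b c d e f` are
`0 1 2 3 4 5`: edges `ab, ad, af, bc, be, cd, ce, de`; vertex `5` (= `f`) is its
leaf. -/
def cofishEdges : Set (Sym2 (Fin 6)) :=
  {s(0, 1), s(0, 3), s(0, 5), s(1, 2), s(1, 4), s(2, 3), s(2, 4), s(3, 4)}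

/-- The graph obtained from `G` by attaching a co-fish to every edge of `M`:
each edge `m = {u, v} ∈ M` is subdivided by a new vertex — the leaf `(m, 5)` of
a fresh copy of the co-fish on the six vertices `(m, 0), …, (m, 5)`. -/
def attachCofish (G : SimpleGraph V) (M : Set (Sym2 V)) :
    SimpleGraph (V ⊕ (↥M × Fin 6)) :=
  SimpleGraph.fromEdgeSet
    ({e | ∃ p q : V, G.Adj p q ∧ s(p, q) ∉ M ∧ e = s(Sum.inl p, Sum.inl q)} ∪
     {e | ∃ (m : ↥M) (p : V), p ∈ (m : Sym2 V) ∧ e = s(Sum.inl p, Sum.inr (m, 5))} ∪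
     {e | ∃ (m : ↥M) (i j : Fin 6), s(i, j) ∈ cofishEdges ∧
        e = s(Sum.inr (m, i), Sum.inr (m, j))})

section Helpers

open Sum

theorem mem_edgeSet_attachCofish {G : SimpleGraph V} {M : Set (Sym2 V)}
    {e : Sym2 (V ⊕ (↥M × Fin 6))} :
    e ∈ (attachCofish G M).edgeSet ↔
      (∃ p q : V, G.Adj p q ∧ s(p, q) ∉ M ∧ e = s(inl p, inl q)) ∨
      (∃ (m : ↥M) (p : V), p ∈ (m : Sym2 V) ∧ e = s(inl p, inr (m, 5))) ∨
      (∃ (m : ↥M) (i j : Fin 6), s(i, j) ∈ cofishEdges ∧ e = s(inr (m, i), inr (m, j))) := by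
  unfold attachCofish
  rw [edgeSet_fromEdgeSet]
  constructor
  · rintro ⟨(h | h) | h, -⟩
    · exact Or.inl h
    · exact Or.inr (Or.inl h)
    · exact Or.inr (Or.inr h)
  · rintro (h | h | h)
    · refine ⟨Or.inl (Or.inl h), ?_⟩
      obtain ⟨p, q, hpq, -, rfl⟩ := h
      simpa using hpq.ne
    · refine ⟨Or.inl (Or.inr h), ?_⟩
      obtain ⟨m, p, -, rfl⟩ := h
      simp
    · refine ⟨Or.inr h, ?_⟩
      obtain ⟨m, i, j, hij, rfl⟩ := h
      suffices i ≠ j by simpa using this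
      rintro rfl
      simp only [cofishEdges, Set.mem_insert_iff, Set.mem_singleton_iff] at hij
      revert i
      decide

/-- A trail `a b c d` with unmarked middle edge that is either a path or a triangle with a
marked edge. -/
def IsMarkedTrail (G : SimpleGraph V) (M : Set (Sym2 V)) (a b c d : V) : Prop :=
  G.Adj a b ∧ G.Adj b c ∧ G.Adj c d ∧ a ≠ c ∧ b ≠ d ∧ s(b, c) ∉ M ∧
    (a = d → s(a, b) ∈ M ∨ s(c, d) ∈ M)

theorem ncard_inter_eq_one_or_two_iff {α : Type*} {P : Finset α} (hP : P.card = 3) (M : Set α) :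
    (((P : Set α) ∩ M).ncard = 1 ∨ ((P : Set α) ∩ M).ncard = 2) ↔
      (∃ e ∈ P, e ∈ M) ∧ ∃ e ∈ P, e ∉ M := by
  have hfin : ((P : Set α) ∩ M).Finite := P.finite_toSet.subset Set.inter_subset_left
  have hle : ((P : Set α) ∩ M).ncard ≤ 3 := by
    rw [← hP, ← Set.ncard_coe_finset]
    exact Set.ncard_le_ncard Set.inter_subset_left P.finite_toSet
  have h0 : ((P : Set α) ∩ M).ncard ≠ 0 ↔ ∃ e ∈ P, e ∈ M := by
    rw [Ne, Set.ncard_eq_zero hfin, ← Ne, ← Set.nonempty_iff_ne_empty]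
    rfl
  have h3 : ((P : Set α) ∩ M).ncard ≠ 3 ↔ ∃ e ∈ P, e ∉ M := by
    rw [← not_iff_not]
    push Not
    constructor
    · intro h e he
      have : (P : Set α) ∩ M = P := Set.eq_of_subset_of_ncard_le Set.inter_subset_left
        (by rw [h, Set.ncard_coe_finset, hP]) P.finite_toSet
      exact (this.symm ▸ Finset.mem_coe.2 he : e ∈ (P : Set α) ∩ M).2
    · intro h
      rw [Set.inter_eq_left.2 (fun e he => h e he), Set.ncard_coe_finset, hP]
  rw [← h0, ← h3]
  omega

theorem IsTriangleOn.card_triEdges [DecidableEq V] {G : SimpleGraph V} {u v w : V}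
    (h : IsTriangleOn G u v w) : (triEdges u v w).card = 3 := by
  obtain ⟨h1, h2, h3⟩ := h
  have := h1.ne; have := h2.ne; have := h3.ne
  rw [triEdges, Finset.card_eq_three]
  refine ⟨_, _, _, ?_, ?_, ?_, rfl⟩ <;> simp <;> grind

theorem exists_isMarkedTrail_iff [DecidableEq V] {G : SimpleGraph V} {M : Set (Sym2 V)}
    {P : Finset (Sym2 V)} :
    (∃ a b c d, IsMarkedTrail G M a b c d ∧ P = p4Edges a b c d) ↔
      (IsTrianglePart G P ∧
        (((P : Set (Sym2 V)) ∩ M).ncard = 1 ∨ ((P : Set (Sym2 V)) ∩ M).ncard = 2)) ∨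
      (∃ a b c d : V, IsP4On G a b c d ∧ P = p4Edges a b c d ∧ s(b, c) ∉ M) := by
  constructor
  · rintro ⟨a, b, c, d, ⟨h1, h2, h3, h4, h5, h6, h7⟩, rfl⟩
    by_cases had : a = d
    · subst had
      left
      have ht : IsTriangleOn G a b c := ⟨h1, h2, h3.symm⟩
      have hP : p4Edges a b c a = triEdges a b c := by
        rw [p4Edges, triEdges, Sym2.eq_swap (a := c)]
      refine ⟨⟨a, b, c, ht, hP⟩, ?_⟩
      rw [hP, ncard_inter_eq_one_or_two_iff ht.card_triEdges]
      refine ⟨?_, s(b, c), by simp [triEdges], h6⟩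
      obtain h | h := h7 rfl
      · exact ⟨_, by simp [triEdges], h⟩
      · exact ⟨_, by simp [triEdges], h⟩
    · exact Or.inr ⟨a, b, c, d, ⟨h1, h2, h3, h4, had, h5⟩, rfl, h6⟩
  · rintro (⟨⟨u, v, w, ht, rfl⟩, h⟩ | ⟨a, b, c, d, ⟨h1, h2, h3, h4, h5, h6⟩, rfl, h7⟩)
    · rw [ncard_inter_eq_one_or_two_iff ht.card_triEdges] at h
      obtain ⟨h1, h2, h3⟩ := ht
      obtain ⟨⟨e, he, heM⟩, e', he', heM'⟩ := h
      have := h1.ne; have := h2.ne; have := h3.ne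
      simp only [triEdges, Finset.mem_insert, Finset.mem_singleton] at he he'
      rcases he' with rfl | rfl | rfl
      · refine ⟨w, u, v, w, ⟨h3.symm, h1, h2, by tauto, by tauto, heM', fun _ => ?_⟩, ?_⟩
        · rw [Sym2.eq_swap (a := w)]
          grind
        · ext x
          simp only [triEdges, p4Edges, Finset.mem_insert, Finset.mem_singleton,
            Sym2.eq_swap (a := w) (b := u)]
          tauto
      · refine ⟨u, v, w, u, ⟨h1, h2, h3.symm, by tauto, by tauto, heM', fun _ => ?_⟩, ?_⟩
        · rw [Sym2.eq_swap (a := w)]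
          grind
        · ext x
          simp only [triEdges, p4Edges, Finset.mem_insert, Finset.mem_singleton,
            Sym2.eq_swap (a := w) (b := u)]
      · refine ⟨v, u, w, v, ⟨h1.symm, h3, h2.symm, by tauto, by tauto, heM', fun _ => ?_⟩, ?_⟩
        · rw [Sym2.eq_swap (a := w), Sym2.eq_swap (a := v) (b := u)]
          grind
        · ext x
          simp only [triEdges, p4Edges, Finset.mem_insert, Finset.mem_singleton,
            Sym2.eq_swap (a := w) (b := v), Sym2.eq_swap (a := v) (b := u)]
          tauto
    · exact ⟨a, b, c, d, ⟨h1, h2, h3, h4, h6, h7, fun h => absurd h h5⟩, rfl⟩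

theorem IsClawPart.card_eq_three [DecidableEq V] {G : SimpleGraph V} {P : Finset (Sym2 V)}
    (h : IsClawPart G P) : P.card = 3 := by
  obtain ⟨c, a, b, d, h1, h2, h3, -, -, -, rfl⟩ := h
  rw [clawEdges, Finset.card_eq_three]
  refine ⟨_, _, _, ?_, ?_, ?_, rfl⟩ <;> simp <;> grind

theorem IsP4Part.card_eq_three [DecidableEq V] {G : SimpleGraph V} {P : Finset (Sym2 V)}
    (h : IsP4Part G P) : P.card = 3 := by
  obtain ⟨a, b, c, d, ⟨h1, h2, h3, h4, h5, h6⟩, rfl⟩ := h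
  have := h1.ne; have := h2.ne; have := h3.ne
  rw [p4Edges, Finset.card_eq_three]
  refine ⟨_, _, _, ?_, ?_, ?_, rfl⟩ <;> simp <;> grind

/-- A predicate on the edges of a claw or path that spreads between incident edges holds for all
edges as soon as it holds for one. -/
theorem forall_of_incident [DecidableEq V] {G : SimpleGraph V} {P : Finset (Sym2 V)}
    (h : IsClawPart G P ∨ IsP4Part G P) {p : Sym2 V → Prop}
    (hp : ∀ e ∈ P, ∀ e' ∈ P, ∀ x, x ∈ e → x ∈ e' → p e → p e')
    {e : Sym2 V} (he : e ∈ P) (hpe : p e) : ∀ e' ∈ P, p e' := by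
  obtain ⟨e₁, e₂, e₃, x, y, rfl, h1, h2, h3, h4⟩ : ∃ e₁ e₂ e₃ : Sym2 V, ∃ x y : V,
      P = {e₁, e₂, e₃} ∧ x ∈ e₁ ∧ x ∈ e₂ ∧ y ∈ e₂ ∧ y ∈ e₃ := by
    obtain ⟨c, a, b, d, -, -, -, -, -, -, rfl⟩ | ⟨a, b, c, d, -, rfl⟩ := h
    · exact ⟨_, _, _, c, c, rfl, by simp⟩
    · exact ⟨_, _, _, b, c, rfl, by simp⟩
  simp only [Finset.mem_insert, Finset.mem_singleton] at *
  have h12 := hp e₁ (by simp) e₂ (by simp) x h1 h2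
  have h21 := hp e₂ (by simp) e₁ (by simp) x h2 h1
  have h23 := hp e₂ (by simp) e₃ (by simp) y h3 h4
  have h32 := hp e₃ (by simp) e₂ (by simp) y h4 h3
  grind

section Lift

variable {M : Set (Sym2 V)}

open Classical in
/-- The edge of the graph with co-fishes attached that represents `e`: a marked edge `e` is
represented by the half of its subdivision at the end `t e`. -/
noncomputable def liftEdge (M : Set (Sym2 V)) (t : Sym2 V → V) (e : Sym2 V) :
    Sym2 (V ⊕ (↥M × Fin 6)) :=
  if h : e ∈ M then s(inl (t e), inr (⟨e, h⟩, 5)) else e.map inl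

theorem liftEdge_of_mem (t : Sym2 V → V) {e : Sym2 V} (h : e ∈ M) :
    liftEdge M t e = s(inl (t e), inr (⟨e, h⟩, 5)) := dif_pos h

theorem liftEdge_of_notMem (t : Sym2 V → V) {e : Sym2 V} (h : e ∉ M) :
    liftEdge M t e = e.map inl := dif_neg h

theorem liftEdge_injective (t : Sym2 V → V) : Function.Injective (liftEdge M t) := by
  intro e e' h
  by_cases he : e ∈ M <;> by_cases he' : e' ∈ M
  · rw [liftEdge_of_mem t he, liftEdge_of_mem t he'] at h
    simp at h
    exact h.2
  · rw [liftEdge_of_mem t he, liftEdge_of_notMem t he'] at h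
    have : (inr (⟨e, he⟩, 5) : V ⊕ (↥M × Fin 6)) ∈ e'.map inl := h ▸ Sym2.mem_mk_right _ _
    simp [Sym2.mem_map] at this
  · rw [liftEdge_of_notMem t he, liftEdge_of_mem t he'] at h
    have : (inr (⟨e', he'⟩, 5) : V ⊕ (↥M × Fin 6)) ∈ e.map inl := h ▸ Sym2.mem_mk_right _ _
    simp [Sym2.mem_map] at this
  · rw [liftEdge_of_notMem t he, liftEdge_of_notMem t he'] at h
    exact Sym2.map.injective Sum.inl_injective h

theorem eq_of_inr_mem_liftEdge {t : Sym2 V → V} {e : Sym2 V} {m : ↥M} {i : Fin 6}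
    (h : inr (m, i) ∈ liftEdge M t e) : e = m ∧ i = 5 := by
  by_cases he : e ∈ M
  · rw [liftEdge_of_mem t he] at h
    simp at h
    exact ⟨by rw [h.1], h.2⟩
  · rw [liftEdge_of_notMem t he] at h
    simp [Sym2.mem_map] at h

theorem mem_of_inl_mem_liftEdge {t : Sym2 V → V} (ht : ∀ e, t e ∈ e) {e : Sym2 V} {v : V}
    (h : inl v ∈ liftEdge M t e) : v ∈ e := by
  by_cases he : e ∈ M
  · rw [liftEdge_of_mem t he] at h
    simp at h
    exact h ▸ ht e
  · rw [liftEdge_of_notMem t he] at h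
    simpa [Sym2.mem_map] using h

theorem liftEdge_mem_edgeSet_iff {G : SimpleGraph V} (hM : M ⊆ G.edgeSet) {t : Sym2 V → V}
    (ht : ∀ e, t e ∈ e) {e : Sym2 V} :
    liftEdge M t e ∈ (attachCofish G M).edgeSet ↔ e ∈ G.edgeSet := by
  rw [mem_edgeSet_attachCofish]
  by_cases he : e ∈ M
  · rw [liftEdge_of_mem t he]
    exact iff_of_true (Or.inr (Or.inl ⟨⟨e, he⟩, t e, ht e, rfl⟩)) (hM he)
  · rw [liftEdge_of_notMem t he]
    induction e with | _ a b
    simp only [Sym2.map_mk]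
    constructor
    · rintro (⟨p, q, h, -, h'⟩ | ⟨m, p, -, h'⟩ | ⟨m, i, j, -, h'⟩)
      · simp at h'
        rcases h' with ⟨rfl, rfl⟩ | ⟨rfl, rfl⟩
        · exact h
        · exact h.symm
      · simp at h'
      · simp at h'
    · intro h
      exact Or.inl ⟨a, b, h, he, rfl⟩

theorem exists_liftEdge_mk (t : Sym2 V → V) {a b : V} (h : t s(a, b) = b) :
    ∃ x : V ⊕ (↥M × Fin 6), liftEdge M t s(a, b) = s(x, inl b) ∧
      ((s(a, b) ∉ M ∧ x = inl a) ∨ ∃ hm : s(a, b) ∈ M, x = inr (⟨s(a, b), hm⟩, 5)) := by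
  by_cases he : s(a, b) ∈ M
  · exact ⟨_, by rw [liftEdge_of_mem t he, h, Sym2.eq_swap], Or.inr ⟨he, rfl⟩⟩
  · exact ⟨_, by rw [liftEdge_of_notMem t he, Sym2.map_mk], Or.inl ⟨he, rfl⟩⟩

variable [DecidableEq V] {G : SimpleGraph V}

theorem IsClawPart.exists_image_liftEdge (hM : M ⊆ G.edgeSet) {P : Finset (Sym2 V)}
    (h : IsClawPart G P) : ∃ t : Sym2 V → V, (∀ e, t e ∈ e) ∧
      IsClawPart (attachCofish G M) (P.image (liftEdge M t)) := by
  obtain ⟨c, a, b, d, hab, had, hbd, ha, hb, hd, rfl⟩ := h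
  have ht : ∀ e : Sym2 V, (if c ∈ e then c else e.out.1) ∈ e := by
    intro e
    split_ifs with h
    · exact h
    · exact Sym2.out_fst_mem e
  refine ⟨_, ht, ?_⟩
  set t : Sym2 V → V := fun e => if c ∈ e then c else e.out.1 with htdef
  have key : ∀ a, ∃ x : V ⊕ (↥M × Fin 6), liftEdge M t s(a, c) = s(x, inl c) := fun a => by
    obtain ⟨x, hx, -⟩ := exists_liftEdge_mk (M := M) (a := a) (b := c) t (by simp [htdef])
    exact ⟨x, hx⟩
  choose x hx using key
  have hadj : ∀ a, G.Adj c a → (attachCofish G M).Adj (inl c) (x a) := by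
    intro a ha
    have := (liftEdge_mem_edgeSet_iff hM ht (e := s(a, c))).2 ha.symm
    rw [show liftEdge M _ s(a, c) = _ from hx a] at this
    exact (mem_edgeSet _ |>.1 this).symm
  have hne : ∀ a b, a ≠ b → x a ≠ x b := by
    intro a b hab h
    have := liftEdge_injective (M := M) t ((hx a).trans ((h ▸ (hx b).symm)))
    simp only [Sym2.congr_left] at this
    exact hab this
  refine ⟨inl c, x a, x b, x d, hne _ _ hab, hne _ _ had, hne _ _ hbd, hadj _ ha, hadj _ hb,
    hadj _ hd, ?_⟩
  simp only [clawEdges, Finset.image_insert, Finset.image_singleton, Sym2.eq_swap (a := c), hx,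
    Sym2.eq_swap (a := inl c)]

theorem IsMarkedTrail.exists_image_liftEdge (hM : M ⊆ G.edgeSet) {a b c d : V}
    (h : IsMarkedTrail G M a b c d) : ∃ t : Sym2 V → V, (∀ e, t e ∈ e) ∧
      IsP4Part (attachCofish G M) ((p4Edges a b c d).image (liftEdge M t)) := by
  obtain ⟨h1, h2, h3, h4, h5, h6, h7⟩ := h
  have hne : s(d, c) ≠ s(a, b) := by
    have := h1.ne; have := h2.ne; have := h3.ne
    simp; grind
  have ht : ∀ e : Sym2 V, (if e = s(a, b) then b else if e = s(d, c) then c else e.out.1) ∈ e := by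
    intro e
    split_ifs with h h'
    · simp [h]
    · simp [h']
    · exact Sym2.out_fst_mem e
  refine ⟨_, ht, ?_⟩
  set t : Sym2 V → V := fun e => if e = s(a, b) then b else if e = s(d, c) then c else e.out.1
    with htdef
  obtain ⟨x, hx, hx'⟩ := exists_liftEdge_mk (M := M) (a := a) (b := b) t (by simp [htdef])
  obtain ⟨y, hy, hy'⟩ := exists_liftEdge_mk (M := M) (a := d) (b := c) t
    (by simp only [htdef, if_neg hne, if_true])
  have hz : liftEdge M t s(b, c) = s(inl b, inl c) := by
    rw [liftEdge_of_notMem t h6, Sym2.map_mk]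
  have e1 := (liftEdge_mem_edgeSet_iff hM ht (e := s(a, b))).2 h1
  have e2 := (liftEdge_mem_edgeSet_iff hM ht (e := s(b, c))).2 h2
  have e3 := (liftEdge_mem_edgeSet_iff hM ht (e := s(d, c))).2 h3.symm
  rw [show liftEdge M _ s(a, b) = _ from hx] at e1
  rw [show liftEdge M _ s(b, c) = _ from hz] at e2
  rw [show liftEdge M _ s(d, c) = _ from hy] at e3
  refine ⟨x, inl b, inl c, y, ⟨e1, e2, e3.symm, ?_, ?_, ?_⟩, ?_⟩
  · rcases hx' with ⟨-, rfl⟩ | ⟨-, rfl⟩ <;> simp [h4]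
  · rw [Sym2.eq_swap (a := c)] at h7
    rcases hx' with ⟨hm, rfl⟩ | ⟨hm, rfl⟩ <;> rcases hy' with ⟨hm', rfl⟩ | ⟨hm', rfl⟩
    · simp only [ne_eq, inl.injEq]
      tauto
    · simp
    · simp
    · intro h
      exact hne (by simpa using h.symm)
  · rcases hy' with ⟨-, rfl⟩ | ⟨-, rfl⟩ <;> simp [h5]
  · simp only [p4Edges, Finset.image_insert, Finset.image_singleton, Sym2.eq_swap (a := c) (b := d),
      hx, hy, hz, Sym2.eq_swap (a := inl c) (b := y)]

theorem exists_image_liftEdge_eq_of_isClawPart (hM : M ⊆ G.edgeSet) {t : Sym2 V → V}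
    (ht : ∀ e, t e ∈ e) {Q : Finset (Sym2 (V ⊕ (↥M × Fin 6)))}
    (hQ : IsClawPart (attachCofish G M) Q) (hlift : ∀ e ∈ Q, ∃ e₀, liftEdge M t e₀ = e) :
    ∃ P, IsClawPart G P ∧ P.image (liftEdge M t) = Q := by
  obtain ⟨c, x, y, z, hxy, hxz, hyz, hx, hy, hz, rfl⟩ := hQ
  obtain ⟨ex, hex⟩ := hlift s(c, x) (by simp [clawEdges])
  obtain ⟨ey, hey⟩ := hlift s(c, y) (by simp [clawEdges])
  obtain ⟨ez, hez⟩ := hlift s(c, z) (by simp [clawEdges])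
  rcases c with c | ⟨m, i⟩
  · obtain ⟨a, rfl⟩ := mem_of_inl_mem_liftEdge (M := M) ht (e := ex) (v := c) (by simp [hex])
    obtain ⟨b, rfl⟩ := mem_of_inl_mem_liftEdge (M := M) ht (e := ey) (v := c) (by simp [hey])
    obtain ⟨d, rfl⟩ := mem_of_inl_mem_liftEdge (M := M) ht (e := ez) (v := c) (by simp [hez])
    refine ⟨clawEdges c a b d, ⟨c, a, b, d, ?_, ?_, ?_, ?_, ?_, ?_, rfl⟩, ?_⟩
    · rintro rfl
      exact hxy (Sym2.congr_right.1 (hex.symm.trans hey))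
    · rintro rfl
      exact hxz (Sym2.congr_right.1 (hex.symm.trans hez))
    · rintro rfl
      exact hyz (Sym2.congr_right.1 (hey.symm.trans hez))
    · exact (liftEdge_mem_edgeSet_iff hM ht).1 (by rwa [hex])
    · exact (liftEdge_mem_edgeSet_iff hM ht).1 (by rwa [hey])
    · exact (liftEdge_mem_edgeSet_iff hM ht).1 (by rwa [hez])
    · simp only [clawEdges, Finset.image_insert, Finset.image_singleton, hex, hey, hez]
  · have h1 := (eq_of_inr_mem_liftEdge (t := t) (e := ex) (m := m) (i := i) (by simp [hex])).1
    have h2 := (eq_of_inr_mem_liftEdge (t := t) (e := ey) (m := m) (i := i) (by simp [hey])).1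
    subst h1 h2
    exact absurd (Sym2.congr_right.1 (hex.symm.trans hey)) hxy

theorem exists_image_liftEdge_eq_of_isP4Part (hM : M ⊆ G.edgeSet) {t : Sym2 V → V}
    (ht : ∀ e, t e ∈ e) {Q : Finset (Sym2 (V ⊕ (↥M × Fin 6)))}
    (hQ : IsP4Part (attachCofish G M) Q) (hlift : ∀ e ∈ Q, ∃ e₀, liftEdge M t e₀ = e) :
    ∃ a b c d, IsMarkedTrail G M a b c d ∧ (p4Edges a b c d).image (liftEdge M t) = Q := by
  obtain ⟨x, y, z, w, ⟨hxy, hyz, hzw, hxz, hxw, hyw⟩, rfl⟩ := hQ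
  obtain ⟨e₁, he₁⟩ := hlift s(x, y) (by simp [p4Edges])
  obtain ⟨e₂, he₂⟩ := hlift s(y, z) (by simp [p4Edges])
  obtain ⟨e₃, he₃⟩ := hlift s(z, w) (by simp [p4Edges])
  have h12 : e₁ ≠ e₂ := by
    rintro rfl
    exact hxz (Sym2.congr_right.1 (Sym2.eq_swap.trans (he₁.symm.trans he₂)))
  have h23 : e₂ ≠ e₃ := by
    rintro rfl
    exact hyw (Sym2.congr_right.1 (Sym2.eq_swap.trans (he₂.symm.trans he₃)))
  rcases y with b | ⟨m, i⟩
  swap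
  · exact absurd ((eq_of_inr_mem_liftEdge (t := t) (m := m) (i := i) (by simp [he₁])).1.trans
      (eq_of_inr_mem_liftEdge (t := t) (m := m) (i := i) (by simp [he₂])).1.symm) h12
  rcases z with c | ⟨m, i⟩
  swap
  · exact absurd ((eq_of_inr_mem_liftEdge (t := t) (m := m) (i := i) (by simp [he₂])).1.trans
      (eq_of_inr_mem_liftEdge (t := t) (m := m) (i := i) (by simp [he₃])).1.symm) h23
  have hbc : b ≠ c := fun h => hyz.ne (by rw [h])
  obtain rfl : e₂ = s(b, c) := ((Sym2.mem_and_mem_iff hbc).1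
    ⟨mem_of_inl_mem_liftEdge (M := M) (e := e₂) ht (by simp [he₂]),
      mem_of_inl_mem_liftEdge (M := M) (e := e₂) ht (by simp [he₂])⟩)
  have hmid : s(b, c) ∉ M := fun h => by
    rw [liftEdge_of_mem t h] at he₂
    simp at he₂
  obtain ⟨a, rfl⟩ := mem_of_inl_mem_liftEdge (M := M) ht (e := e₁) (v := b) (by simp [he₁])
  obtain ⟨d, rfl⟩ := mem_of_inl_mem_liftEdge (M := M) ht (e := e₃) (v := c) (by simp [he₃])
  refine ⟨a, b, c, d, ⟨?_, ?_, ?_, ?_, ?_, hmid, ?_⟩, ?_⟩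
  · exact ((liftEdge_mem_edgeSet_iff hM ht (e := s(b, a))).1 (he₁ ▸ hxy)).symm
  · exact (liftEdge_mem_edgeSet_iff hM ht).1 (by rwa [he₂])
  · exact (liftEdge_mem_edgeSet_iff hM ht).1 (by rwa [he₃])
  · rintro rfl
    exact h12 rfl
  · rintro rfl
    exact h23 Sym2.eq_swap
  · rintro rfl
    by_contra! h
    rw [Sym2.eq_swap] at h
    rw [liftEdge_of_notMem t h.1] at he₁
    rw [liftEdge_of_notMem t h.2] at he₃
    rw [Sym2.eq_swap (a := x)] at he₁
    simp only [Sym2.map_mk, Sym2.congr_right] at he₁ he₃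
    exact hxw (he₁.symm.trans he₃)
  · simp only [p4Edges, Finset.image_insert, Finset.image_singleton, Sym2.eq_swap (a := a), he₁,
      he₂, he₃]

end Lift

section Gadget

variable {M : Set (Sym2 V)}

/-- The embedding of a co-fish whose leaf `5` has an additional neighbour `6`, as the co-fish
attached at `m` together with the vertex `v` of the original graph. -/
def gadgetVertex (m : ↥M) (v : V) (i : Fin 7) : V ⊕ (↥M × Fin 6) :=
  if h : (i : ℕ) < 6 then inr (m, ⟨i, h⟩) else inl v

theorem gadgetVertex_injective (m : ↥M) (v : V) : Function.Injective (gadgetVertex m v) := by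
  intro i j h
  unfold gadgetVertex at h
  split_ifs at h <;> simp at h <;> omega

theorem gadgetVertex_eq_inr {m m' : ↥M} {v : V} {i : Fin 7} {j : Fin 6}
    (h : gadgetVertex m v i = inr (m', j)) : m = m' ∧ i = j.castSucc := by
  unfold gadgetVertex at h
  split_ifs at h
  simp at h
  refine ⟨h.1, ?_⟩
  rw [← h.2]
  rfl

@[simp] theorem gadgetVertex_castSucc (m : ↥M) (v : V) (i : Fin 6) :
    gadgetVertex m v i.castSucc = inr (m, i) := by
  simp [gadgetVertex]

@[simp] theorem gadgetVertex_last (m : ↥M) (v : V) : gadgetVertex m v 6 = inl v := by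
  simp [gadgetVertex]

/-- The parts of a decomposition of the co-fish with an additional edge at its leaf. -/
def gadgetParts : Finset (Finset (Sym2 (Fin 7))) :=
  {p4Edges 6 5 0 1, p4Edges 0 3 2 1, clawEdges 4 1 2 3}

theorem eq_of_mem_gadgetParts : ∀ R ∈ gadgetParts, ∀ R' ∈ gadgetParts, ∀ ε ∈ R, ε ∈ R' →
    R = R' := by
  intro R hR R' hR' ε hε hε'
  simp only [gadgetParts, Finset.mem_insert, Finset.mem_singleton] at hR hR'
  rcases hR with rfl | rfl | rfl <;> rcases hR' with rfl | rfl | rfl <;> first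
    | rfl
    | simp only [p4Edges, clawEdges, Finset.mem_insert, Finset.mem_singleton] at hε hε'
      rcases hε with rfl | rfl | rfl <;> revert hε' <;> decide

theorem exists_mem_gadgetParts {i j : Fin 6} (h : s(i, j) ∈ cofishEdges) :
    ∃ R ∈ gadgetParts, s(i.castSucc, j.castSucc) ∈ R := by
  simp only [cofishEdges, Set.mem_insert_iff, Set.mem_singleton_iff] at h
  revert i j
  decide

theorem eq_or_exists_castSucc_mem : ∀ R ∈ gadgetParts, ∀ ε ∈ R,
    ε = s(6, 5) ∨ ∃ i : Fin 6, i ≠ 5 ∧ i.castSucc ∈ ε := by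
  intro R hR ε hε
  simp only [gadgetParts, Finset.mem_insert, Finset.mem_singleton] at hR
  rcases hR with rfl | rfl | rfl <;>
    simp only [p4Edges, clawEdges, Finset.mem_insert, Finset.mem_singleton] at hε <;>
    rcases hε with rfl | rfl | rfl <;> decide

theorem exists_castSucc_mem : ∀ R ∈ gadgetParts, ∀ ε ∈ R, ∃ i : Fin 6, i.castSucc ∈ ε := by
  intro R hR ε hε
  simp only [gadgetParts, Finset.mem_insert, Finset.mem_singleton] at hR
  rcases hR with rfl | rfl | rfl <;>
    simp only [p4Edges, clawEdges, Finset.mem_insert, Finset.mem_singleton] at hε <;>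
    rcases hε with rfl | rfl | rfl <;> decide

theorem adj_gadgetVertex_castSucc {G : SimpleGraph V} (m : ↥M) (v : V) {i j : Fin 6}
    (h : s(i, j) ∈ cofishEdges) :
    (attachCofish G M).Adj (gadgetVertex m v i.castSucc) (gadgetVertex m v j.castSucc) := by
  rw [← mem_edgeSet, mem_edgeSet_attachCofish]
  exact Or.inr (Or.inr ⟨m, i, j, h, by simp⟩)

theorem eq_of_map_gadgetVertex_eq {m m' : ↥M} {v v' : V} {R : Finset (Sym2 (Fin 7))}
    (hR : R ∈ gadgetParts) {ε ε' : Sym2 (Fin 7)} (hε : ε ∈ R)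
    (h : ε.map (gadgetVertex m v) = ε'.map (gadgetVertex m' v')) : m = m' := by
  obtain ⟨i, hi⟩ := exists_castSucc_mem R hR ε hε
  have : gadgetVertex m v i.castSucc ∈ ε'.map (gadgetVertex m' v') :=
    h ▸ Sym2.mem_map.2 ⟨_, hi, rfl⟩
  obtain ⟨j, -, hj⟩ := Sym2.mem_map.1 this
  rw [gadgetVertex_castSucc] at hj
  exact (gadgetVertex_eq_inr hj).1.symm

theorem map_gadgetVertex_ne_liftEdge {t : Sym2 V → V} {m : ↥M} {v : V} (hv : t m ≠ v)
    {R : Finset (Sym2 (Fin 7))} (hR : R ∈ gadgetParts) {ε : Sym2 (Fin 7)} (hε : ε ∈ R)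
    (e : Sym2 V) : liftEdge M t e ≠ ε.map (gadgetVertex m v) := by
  intro h
  obtain rfl | ⟨i, hi5, hi⟩ := eq_or_exists_castSucc_mem R hR ε hε
  · rw [Sym2.map_mk, gadgetVertex_last,
      show gadgetVertex m v 5 = inr (m, 5) from gadgetVertex_castSucc m v 5] at h
    obtain ⟨rfl, -⟩ := eq_of_inr_mem_liftEdge (t := t) (e := e) (m := m) (i := 5) (by simp [h])
    rw [liftEdge_of_mem t m.2] at h
    simp only [Sym2.congr_left, inl.injEq] at h
    exact hv h
  · have : gadgetVertex m v i.castSucc ∈ liftEdge M t e := h ▸ Sym2.mem_map.2 ⟨_, hi, rfl⟩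
    rw [gadgetVertex_castSucc] at this
    exact hi5 (eq_of_inr_mem_liftEdge this).2

variable [DecidableEq V] {G : SimpleGraph V}

theorem isClawPart_or_isP4Part_gadget (m : ↥M) {v : V} (hv : v ∈ (m : Sym2 V))
    {R : Finset (Sym2 (Fin 7))} (hR : R ∈ gadgetParts) :
    IsClawPart (attachCofish G M) (R.image (Sym2.map (gadgetVertex m v))) ∨
      IsP4Part (attachCofish G M) (R.image (Sym2.map (gadgetVertex m v))) := by
  have hadj : ∀ i j : Fin 6, s(i, j) ∈ cofishEdges →
      (attachCofish G M).Adj (gadgetVertex m v i.castSucc) (gadgetVertex m v j.castSucc) :=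
    fun i j => adj_gadgetVertex_castSucc m v
  have h65 : (attachCofish G M).Adj (gadgetVertex m v 6) (gadgetVertex m v 5) := by
    rw [← mem_edgeSet, mem_edgeSet_attachCofish]
    exact Or.inr (Or.inl ⟨m, v, hv, by simp [gadgetVertex]⟩)
  have hinj := gadgetVertex_injective m v
  simp only [gadgetParts, Finset.mem_insert, Finset.mem_singleton] at hR
  rcases hR with rfl | rfl | rfl
  · refine Or.inr ⟨_, _, _, _, ⟨h65, hadj 5 0 ?_, hadj 0 1 ?_, ?_, ?_, ?_⟩, ?_⟩
    · simp [cofishEdges]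
    · simp [cofishEdges]
    · exact hinj.ne (by decide)
    · exact hinj.ne (by decide)
    · exact hinj.ne (by decide)
    · simp only [p4Edges, Finset.image_insert, Finset.image_singleton, Sym2.map_mk]
      rfl
  · refine Or.inr ⟨_, _, _, _, ⟨hadj 0 3 ?_, hadj 3 2 ?_, hadj 2 1 ?_, ?_, ?_, ?_⟩, ?_⟩
    · simp [cofishEdges]
    · simp [cofishEdges]
    · simp [cofishEdges]
    · exact hinj.ne (by decide)
    · exact hinj.ne (by decide)
    · exact hinj.ne (by decide)
    · simp only [p4Edges, Finset.image_insert, Finset.image_singleton, Sym2.map_mk]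
      rfl
  · refine Or.inl ⟨_, _, _, _, ?_, ?_, ?_, hadj 4 1 ?_, hadj 4 2 ?_, hadj 4 3 ?_, ?_⟩
    · exact hinj.ne (by decide)
    · exact hinj.ne (by decide)
    · exact hinj.ne (by decide)
    · simp [cofishEdges]
    · simp [cofishEdges]
    · simp [cofishEdges]
    · simp only [clawEdges, Finset.image_insert, Finset.image_singleton, Sym2.map_mk]
      rfl

theorem IsMarkedDecompOn.exists_isDecompOn [Fintype V] (hM : M ⊆ G.edgeSet)
    {D : Finset (Finset (Sym2 V))} (hD : IsMarkedDecompOn G M D) :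
    ∃ D' : Finset (Finset (Sym2 (V ⊕ (↥M × Fin 6)))),
      IsDecompOn (attachCofish G M)
        (fun P => IsClawPart (attachCofish G M) P ∨ IsP4Part (attachCofish G M) P) D' := by
  classical
  obtain ⟨hparts, hdisj, hcover⟩ := hD
  have hlift : ∀ P : Finset (Sym2 V), ∃ τ : Sym2 V → V, (∀ e, τ e ∈ e) ∧
      (P ∈ D → IsClawPart (attachCofish G M) (P.image (liftEdge M τ)) ∨
        IsP4Part (attachCofish G M) (P.image (liftEdge M τ))) := by
    intro P
    by_cases hP : P ∈ D
    · rcases hparts P hP with h | h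
      · obtain ⟨τ, hτ, h⟩ := h.exists_image_liftEdge hM
        exact ⟨τ, hτ, fun _ => Or.inl h⟩
      · obtain ⟨a, b, c, d, htrail, rfl⟩ := exists_isMarkedTrail_iff.2 h
        obtain ⟨τ, hτ, h⟩ := htrail.exists_image_liftEdge hM
        exact ⟨τ, hτ, fun _ => Or.inr h⟩
    · exact ⟨fun e => e.out.1, Sym2.out_fst_mem, fun h => absurd h hP⟩
  choose τ hτ hτ' using hlift
  have huniq : ∀ P ∈ D, ∀ P' ∈ D, ∀ e ∈ P, e ∈ P' → P = P' := fun P hP P' hP' e he he' =>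
    hdisj.elim_finset hP hP' e he he'
  have hpart : ∀ e : Sym2 V, ∃ P, ∀ P' ∈ D, e ∈ P' → P' = P := by
    intro e
    by_cases h : ∃ P ∈ D, e ∈ P
    · obtain ⟨P, hP, he⟩ := h
      exact ⟨P, fun P' hP' he' => huniq P' hP' P hP e he' he⟩
    · exact ⟨∅, fun P' hP' he' => absurd ⟨P', hP', he'⟩ h⟩
  choose part hpart using hpart
  set t : Sym2 V → V := fun e => τ (part e) e with htdef
  have ht : ∀ e, t e ∈ e := fun e => hτ _ _
  have himage : ∀ P ∈ D, P.image (liftEdge M t) = P.image (liftEdge M (τ P)) := by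
    intro P hP
    refine Finset.image_congr fun e he => ?_
    have : t e = τ P e := by rw [htdef, hpart e P hP he]
    simp only [liftEdge, this]
  have hother : ∀ m : ↥M, ∃ v, (m : Sym2 V) = s(t m, v) := fun m => (ht m)
  choose o ho using hother
  have hne : ∀ m : ↥M, t m ≠ o m := fun m => by
    have := hM m.2
    rw [ho m, mem_edgeSet] at this
    exact this.ne
  have hom : ∀ m : ↥M, o m ∈ (m : Sym2 V) := fun m => by
    rw [ho m]
    exact Sym2.mem_mk_right _ _
  set D' : Finset (Finset (Sym2 (V ⊕ (↥M × Fin 6)))) :=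
    D.image (fun P => P.image (liftEdge M t)) ∪
      (Finset.univ ×ˢ gadgetParts).image
        (fun x : ↥M × Finset (Sym2 (Fin 7)) => x.2.image (Sym2.map (gadgetVertex x.1 (o x.1))))
    with hD'
  have hmem : ∀ Q, Q ∈ D' ↔ (∃ P ∈ D, P.image (liftEdge M t) = Q) ∨
      ∃ m : ↥M, ∃ R ∈ gadgetParts, R.image (Sym2.map (gadgetVertex m (o m))) = Q := by
    intro Q
    simp [hD']
  have hvalid : ∀ Q ∈ D', IsClawPart (attachCofish G M) Q ∨ IsP4Part (attachCofish G M) Q := by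
    intro Q hQ
    obtain ⟨P, hP, rfl⟩ | ⟨m, R, hR, rfl⟩ := (hmem Q).1 hQ
    · rw [himage P hP]
      exact hτ' P hP
    · exact isClawPart_or_isP4Part_gadget m (hom m) hR
  refine ⟨D', hvalid, ?_, ?_⟩
  · intro Q hQ Q' hQ' hQQ'
    rw [Function.onFun, id, id, Finset.disjoint_left]
    intro e he he'
    apply hQQ'
    obtain ⟨P, hP, rfl⟩ | ⟨m, R, hR, rfl⟩ := (hmem Q).1 hQ <;>
    obtain ⟨P', hP', rfl⟩ | ⟨m', R', hR', rfl⟩ := (hmem Q').1 hQ' <;>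
    obtain ⟨e₀, he₀, rfl⟩ := Finset.mem_image.1 he <;>
    obtain ⟨e₀', he₀', heq⟩ := Finset.mem_image.1 he'
    · obtain rfl := liftEdge_injective t heq
      rw [huniq P hP P' hP' _ he₀ he₀']
    · exact absurd heq.symm (map_gadgetVertex_ne_liftEdge (hne m') hR' he₀' _)
    · exact absurd heq (map_gadgetVertex_ne_liftEdge (hne m) hR he₀ _)
    · obtain rfl := eq_of_map_gadgetVertex_eq hR' he₀' heq
      obtain rfl := Sym2.map.injective (gadgetVertex_injective _ _) heq
      rw [eq_of_mem_gadgetParts R hR R' hR' _ he₀ he₀']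
  · intro e
    constructor
    · intro he
      have hl : ∀ e₀, liftEdge M t e₀ = e → ∃ Q ∈ D', e ∈ Q := by
        rintro e₀ rfl
        obtain ⟨P, hP, h⟩ := (hcover e₀).1 ((liftEdge_mem_edgeSet_iff hM ht).1 he)
        exact ⟨_, (hmem _).2 (Or.inl ⟨P, hP, rfl⟩), Finset.mem_image_of_mem _ h⟩
      have hg : ∀ m ε, (∃ R ∈ gadgetParts, ε ∈ R) → ε.map (gadgetVertex m (o m)) = e →
          ∃ Q ∈ D', e ∈ Q := by
        rintro m ε ⟨R, hR, h⟩ rfl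
        exact ⟨_, (hmem _).2 (Or.inr ⟨m, R, hR, rfl⟩), Finset.mem_image_of_mem _ h⟩
      obtain ⟨p, q, -, hpq, rfl⟩ | ⟨m, p, hp, rfl⟩ | ⟨m, i, j, hij, rfl⟩ :=
        mem_edgeSet_attachCofish.1 he
      · exact hl s(p, q) (by rw [liftEdge_of_notMem t hpq, Sym2.map_mk])
      · rw [ho m, Sym2.mem_iff] at hp
        rcases hp with rfl | rfl
        · exact hl m (liftEdge_of_mem t m.2)
        · exact hg m s(6, 5) (by decide) (by simp [gadgetVertex])
      · exact hg m s(i.castSucc, j.castSucc) (exists_mem_gadgetParts hij) (by simp)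
    · rintro ⟨Q, hQ, he⟩
      obtain ⟨c, a, b, d, -, -, -, h1, h2, h3, rfl⟩ | ⟨a, b, c, d, ⟨h1, h2, h3, -⟩, rfl⟩ :=
        hvalid Q hQ
      · simp only [clawEdges, Finset.mem_insert, Finset.mem_singleton] at he
        rcases he with rfl | rfl | rfl <;> assumption
      · simp only [p4Edges, Finset.mem_insert, Finset.mem_singleton] at he
        rcases he with rfl | rfl | rfl <;> assumption

end Gadget

section Restrict

variable {M : Set (Sym2 V)} [DecidableEq V] {G : SimpleGraph V}

theorem eq_of_mem_cofishEdges_of_eq_five {i j : Fin 6} (h : s(i, j) ∈ cofishEdges)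
    (h5 : i = 5 ∨ j = 5) : s(i, j) = s(0, 5) ∧ i ≠ j := by
  simp only [cofishEdges, Set.mem_insert_iff, Set.mem_singleton_iff] at h
  revert i j
  decide

theorem exists_finset_coe_eq_cofishEdges :
    ∃ S : Finset (Sym2 (Fin 6)), (S : Set (Sym2 (Fin 6))) = cofishEdges ∧ S.card = 8 :=
  ⟨{s(0, 1), s(0, 3), s(0, 5), s(1, 2), s(1, 4), s(2, 3), s(2, 4), s(3, 4)},
    by simp [cofishEdges], by decide⟩

/-- The part containing the bridge of an attached co-fish consists of the bridge, another edge
of the co-fish and one half of the subdivided edge. -/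
theorem exists_part_of_bridge {D' : Finset (Finset (Sym2 (V ⊕ (↥M × Fin 6))))}
    (hD' : IsDecompOn (attachCofish G M)
      (fun P => IsClawPart (attachCofish G M) P ∨ IsP4Part (attachCofish G M) P) D') (m : ↥M) :
    ∃ Q ∈ D', ∃ u ∈ (m : Sym2 V), s(inr (m, 0), inr (m, 5)) ∈ Q ∧ s(inl u, inr (m, 5)) ∈ Q ∧
      ∀ e ∈ Q, e = s(inl u, inr (m, 5)) ∨
        ∃ i j : Fin 6, s(i, j) ∈ cofishEdges ∧ e = s(inr (m, i), inr (m, j)) := by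
  obtain ⟨hparts, hdisj, hcover⟩ := hD'
  have hcard : ∀ Q ∈ D', Q.card = 3 := fun Q hQ =>
    (hparts Q hQ).elim (·.card_eq_three) (·.card_eq_three)
  obtain ⟨S, hS, hS8⟩ := exists_finset_coe_eq_cofishEdges
  have hinj : Function.Injective
      (Sym2.map fun i : Fin 6 => (inr (m, i) : V ⊕ (↥M × Fin 6))) :=
    Sym2.map.injective fun i j h => by simpa using h
  set C : Finset (Sym2 (V ⊕ (↥M × Fin 6))) := S.image (Sym2.map fun i => inr (m, i)) with hC
  have hC8 : C.card = 8 := by rw [hC, Finset.card_image_of_injective _ hinj, hS8]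
  have hmemC : ∀ e, e ∈ C ↔
      ∃ i j : Fin 6, s(i, j) ∈ cofishEdges ∧ e = s(inr (m, i), inr (m, j)) := by
    intro e
    rw [hC, Finset.mem_image, ← hS]
    constructor
    · rintro ⟨ε, hε, rfl⟩
      induction ε with | _ i j
      exact ⟨i, j, hε, rfl⟩
    · rintro ⟨i, j, h, rfl⟩
      exact ⟨s(i, j), h, rfl⟩
  have hCedge : ∀ e ∈ C, e ∈ (attachCofish G M).edgeSet := fun e he =>
    mem_edgeSet_attachCofish.2 (Or.inr (Or.inr ⟨m, (hmemC e).1 he⟩))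
  have hbridge : s(inr (m, 0), inr (m, 5)) ∈ C :=
    (hmemC _).2 ⟨0, 5, by simp [cofishEdges], rfl⟩
  have hstep : ∀ Q ∈ D', ∀ e ∈ Q, ∀ e' ∈ Q, ∀ x, x ∈ e → x ∈ e' → e ∈ C → e' ∈ C ∨
      (s(inr (m, 0), inr (m, 5)) ∈ Q ∧ ∃ u ∈ (m : Sym2 V), e' = s(inl u, inr (m, 5))) := by
    intro Q hQ e he e' he' x hx hx' heC
    obtain ⟨i, j, hij, rfl⟩ := (hmemC e).1 heC
    obtain ⟨p, q, -, -, rfl⟩ | ⟨m', p, hp, rfl⟩ | ⟨m', i', j', hij', rfl⟩ :=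
      mem_edgeSet_attachCofish.1 ((hcover e').2 ⟨Q, hQ, he'⟩)
    · simp only [Sym2.mem_iff] at hx hx'
      rcases hx with rfl | rfl <;> simp at hx'
    · have h5 : m = m' ∧ (i = 5 ∨ j = 5) := by
        simp only [Sym2.mem_iff] at hx hx'
        rcases hx with rfl | rfl <;> simp at hx' <;> tauto
      obtain ⟨rfl, h5⟩ := h5
      refine Or.inr ⟨?_, p, hp, rfl⟩
      have := congrArg (Sym2.map fun i : Fin 6 => (inr (m, i) : V ⊕ (↥M × Fin 6)))
        (eq_of_mem_cofishEdges_of_eq_five hij h5).1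
      simp only [Sym2.map_mk] at this
      rwa [← this]
    · have : m = m' := by
        simp only [Sym2.mem_iff] at hx hx'
        rcases hx with rfl | rfl <;> simp at hx' <;> tauto
      subst this
      exact Or.inl ((hmemC _).2 ⟨i', j', hij', rfl⟩)
  obtain ⟨Q, hQ, hbQ⟩ := (hcover _).1 (hCedge _ hbridge)
  have hdvd : ∀ Q' ∈ D'.erase Q, 3 ∣ (Q' ∩ C).card := by
    intro Q' hQ'
    obtain ⟨hne, hQ'⟩ := Finset.mem_erase.1 hQ'
    obtain h | ⟨e, he⟩ := (Q' ∩ C).eq_empty_or_nonempty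
    · simp [h]
    · obtain ⟨he, heC⟩ := Finset.mem_inter.1 he
      have hall := forall_of_incident (hparts Q' hQ') (p := (· ∈ C))
        (fun e he e' he' x hx hx' heC => (hstep Q' hQ' e he e' he' x hx hx' heC).resolve_right
          fun h => hne (hdisj.elim_finset hQ' hQ _ h.1 hbQ)) he heC
      rw [Finset.inter_eq_left.2 hall, hcard Q' hQ']
  have hsum : ∑ Q' ∈ D', (Q' ∩ C).card = 8 := by
    rw [← hC8, ← Finset.card_biUnion]
    · congr 1
      ext e
      simp only [Finset.mem_biUnion, Finset.mem_inter]
      constructor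
      · rintro ⟨-, -, -, h⟩
        exact h
      · intro h
        obtain ⟨Q', hQ', he⟩ := (hcover e).1 (hCedge e h)
        exact ⟨Q', hQ', he, h⟩
    · intro Q₁ h₁ Q₂ h₂ h
      exact (hdisj h₁ h₂ h).mono Finset.inter_subset_left Finset.inter_subset_left
  have htwo : (Q ∩ C).card = 2 := by
    rw [← Finset.add_sum_erase _ _ hQ] at hsum
    have := Finset.dvd_sum hdvd
    have := Finset.card_le_card (Finset.inter_subset_left : Q ∩ C ⊆ Q)
    have := hcard Q hQ
    omega
  have hone : (Q \ C).card = 1 := by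
    have := Finset.card_inter_add_card_sdiff Q C
    have := hcard Q hQ
    omega
  obtain ⟨e₁, he₁⟩ := Finset.card_eq_one.1 hone
  have hexit : ∃ e' ∈ Q, e' ∉ C ∧ ∃ u ∈ (m : Sym2 V), e' = s(inl u, inr (m, 5)) := by
    by_contra! h
    have hall := forall_of_incident (hparts Q hQ) (p := (· ∈ C))
      (fun e he e' he' x hx hx' heC => by
        by_contra hn
        obtain ⟨-, u, hu, heq⟩ := (hstep Q hQ e he e' he' x hx hx' heC).resolve_left hn
        exact h e' he' hn u hu heq) hbQ hbridge
    rw [Finset.sdiff_eq_empty_iff_subset.2 hall] at hone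
    simp at hone
  obtain ⟨e', he', hn, u, hu, rfl⟩ := hexit
  refine ⟨Q, hQ, u, hu, hbQ, he', fun e he => ?_⟩
  rw [← hmemC]
  by_cases heC : e ∈ C
  · exact Or.inr heC
  · left
    have h1 : e ∈ Q \ C := Finset.mem_sdiff.2 ⟨he, heC⟩
    have h2 : s(inl u, inr (m, 5)) ∈ Q \ C := Finset.mem_sdiff.2 ⟨he', hn⟩
    rw [he₁, Finset.mem_singleton] at h1 h2
    rw [h1, h2]

theorem exists_isMarkedDecompOn_of_isDecompOn [Fintype V] (hM : M ⊆ G.edgeSet)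
    {D' : Finset (Finset (Sym2 (V ⊕ (↥M × Fin 6))))}
    (hD' : IsDecompOn (attachCofish G M)
      (fun P => IsClawPart (attachCofish G M) P ∨ IsP4Part (attachCofish G M) P) D') :
    ∃ D : Finset (Finset (Sym2 V)), IsMarkedDecompOn G M D := by
  classical
  choose B hB u hu hbB huB hBall using exists_part_of_bridge hD'
  obtain ⟨hparts, hdisj, hcover⟩ := hD'
  have hexists : ∀ e : Sym2 V, ∃ v ∈ e, ∀ h : e ∈ M, e = s(u ⟨e, h⟩, v) := by
    intro e
    by_cases h : e ∈ M
    · obtain ⟨v, hv⟩ := hu ⟨e, h⟩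
      change e = _ at hv
      refine ⟨v, ?_, fun _ => hv⟩
      have := Sym2.mem_mk_right (u ⟨e, h⟩) v
      rwa [← hv] at this
    · exact ⟨e.out.1, Sym2.out_fst_mem e, fun h' => absurd h' h⟩
  choose t ht htu using hexists
  have hne : ∀ m : ↥M, u m ≠ t m := fun m => by
    have := hM m.2
    rw [htu m m.2, mem_edgeSet] at this
    exact this.ne
  have hnot : ∀ m e, liftEdge M t e ∉ B m := by
    intro m e he
    rcases hBall m _ he with h | ⟨i, j, hij, h⟩
    · obtain ⟨rfl, -⟩ := eq_of_inr_mem_liftEdge (t := t) (e := e) (m := m) (i := 5) (by simp [h])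
      rw [liftEdge_of_mem t m.2] at h
      simp only [Sym2.congr_left, inl.injEq] at h
      exact hne m h.symm
    · have hi := (eq_of_inr_mem_liftEdge (t := t) (e := e) (m := m) (i := i) (by simp [h])).2
      have hj := (eq_of_inr_mem_liftEdge (t := t) (e := e) (m := m) (i := j) (by simp [h])).2
      exact (eq_of_mem_cofishEdges_of_eq_five hij (Or.inl hi)).2 (hi.trans hj.symm)
  have hspread : ∀ Q ∈ D', ∀ e ∈ Q, ∀ e' ∈ Q, ∀ x, x ∈ e → x ∈ e' →
      (∃ e₀, liftEdge M t e₀ = e) → ∃ e₀, liftEdge M t e₀ = e' := by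
    rintro Q hQ _ he e' he' x hx hx' ⟨e₀, rfl⟩
    have hB' : ∀ m, e' ∉ B m := fun m h =>
      hnot m e₀ (hdisj.elim_finset hQ (hB m) _ he' h ▸ he)
    obtain ⟨p, q, -, hpq, rfl⟩ | ⟨m, p, hp, rfl⟩ | ⟨m, i, j, hij, rfl⟩ :=
      mem_edgeSet_attachCofish.1 ((hcover e').2 ⟨Q, hQ, he'⟩)
    · exact ⟨s(p, q), by rw [liftEdge_of_notMem t hpq, Sym2.map_mk]⟩
    · rw [htu m m.2, Sym2.mem_iff] at hp
      rcases hp with rfl | rfl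
      · exact absurd (huB m) (hB' m)
      · exact ⟨m, liftEdge_of_mem t m.2⟩
    · have h5 : i = 5 ∨ j = 5 := by
        rcases Sym2.mem_iff.1 hx' with rfl | rfl
        · exact Or.inl (eq_of_inr_mem_liftEdge hx).2
        · exact Or.inr (eq_of_inr_mem_liftEdge hx).2
      have := congrArg (Sym2.map fun i : Fin 6 => (inr (m, i) : V ⊕ (↥M × Fin 6)))
        (eq_of_mem_cofishEdges_of_eq_five hij h5).1
      simp only [Sym2.map_mk] at this
      exact absurd (this ▸ hbB m) (hB' m)
  have hinj := liftEdge_injective (M := M) t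
  have hpull : ∀ Q ∈ D', ∀ e, liftEdge M t e ∈ Q → ∃ P : Finset (Sym2 V),
      (IsClawPart G P ∨ ∃ a b c d, IsMarkedTrail G M a b c d ∧ P = p4Edges a b c d) ∧
        P.image (liftEdge M t) = Q := by
    intro Q hQ e he
    have hall := forall_of_incident (hparts Q hQ) (hspread Q hQ) he ⟨e, rfl⟩
    rcases hparts Q hQ with h | h
    · obtain ⟨P, hP, h⟩ := exists_image_liftEdge_eq_of_isClawPart hM ht h hall
      exact ⟨P, Or.inl hP, h⟩
    · obtain ⟨a, b, c, d, hP, h⟩ := exists_image_liftEdge_eq_of_isP4Part hM ht h hall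
      exact ⟨_, Or.inr ⟨a, b, c, d, hP, rfl⟩, h⟩
  refine ⟨Finset.univ.filter fun P => P.image (liftEdge M t) ∈ D', ?_, ?_, ?_⟩
  · intro P hP
    rw [Finset.mem_filter] at hP
    have hcard : (P.image (liftEdge M t)).card = 3 :=
      (hparts _ hP.2).elim (·.card_eq_three) (·.card_eq_three)
    obtain ⟨_, he⟩ := Finset.card_pos.1 (by rw [hcard]; norm_num)
    obtain ⟨e, -, rfl⟩ := Finset.mem_image.1 he
    obtain ⟨P', hP', h⟩ := hpull _ hP.2 e he
    obtain rfl := Finset.image_injective hinj h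
    exact hP'.imp_right exists_isMarkedTrail_iff.1
  · intro P hP P' hP' hPP'
    simp only [Finset.coe_filter, Finset.mem_univ, true_and, Set.mem_ofPred_eq] at hP hP'
    rw [Function.onFun, id, id, ← Finset.disjoint_image hinj]
    exact hdisj hP hP' ((Finset.image_injective hinj).ne hPP')
  · intro e
    rw [← liftEdge_mem_edgeSet_iff hM ht, hcover]
    constructor
    · rintro ⟨Q, hQ, he⟩
      obtain ⟨P, -, rfl⟩ := hpull Q hQ e he
      exact ⟨P, by simpa using hQ, (hinj.mem_finset_image).1 he⟩
    · rintro ⟨P, hP, he⟩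
      exact ⟨_, (Finset.mem_filter.1 hP).2, Finset.mem_image_of_mem _ he⟩

end Restrict

end Helpers

/-- A cubic graph with marked edge set `M` admits a marked
{K₁,₃, K₃, P₄}-decomposition iff the cubic graph obtained by attaching a
co-fish to every marked edge admits a {K₁,₃, P₄}-decomposition. -/
theorem stmt_15 [Fintype V] [DecidableEq V] (G : SimpleGraph V)
    (hcubic : ∀ v : V, (G.neighborSet v).ncard = 3)
    (M : Set (Sym2 V)) (hM : M ⊆ G.edgeSet) :
    (∃ D : Finset (Finset (Sym2 V)), IsMarkedDecompOn G M D) ↔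
      ∃ D' : Finset (Finset (Sym2 (V ⊕ (↥M × Fin 6)))),
        IsDecompOn (attachCofish G M)
          (fun P => IsClawPart (attachCofish G M) P ∨
            IsP4Part (attachCofish G M) P) D' := by
  exact ⟨fun ⟨_, hD⟩ => hD.exists_isDecompOn hM,
    fun ⟨_, hD'⟩ => exists_isMarkedDecompOn_of_isDecompOn hM hD'⟩
end

section
/- Let G be a connected non-bipartite cubic graph all of whose triangles are isolated, and suppose G admits a {K_{1,3}, K_3}-decomposition D. Let G' be the graph obtained from G by deleting the edges of all isolated triangles of G. Then the parts of D are exactly the isolated triangles of G together with a partition of the edge set of G' into claws K_{1,3}; in particular, G admits a {K_{1,3}, K_3}-decomposition if and only if G' admits a {K_{1,3}}-decomposition. -/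
open SimpleGraph

variable {V : Type*}

/-- The triangle on `u v w` is isolated: no further vertex forms a triangle with
two of its vertices. -/
def IsIsolatedTriangle (G : SimpleGraph V) (u v w : V) : Prop :=
  IsTriangleOn G u v w ∧ ∀ x : V, x ≠ u → x ≠ v → x ≠ w →
    ¬ IsTriangleOn G u v x ∧ ¬ IsTriangleOn G u x w ∧ ¬ IsTriangleOn G x v w

theorem IsTriangleOn.rotate {G : SimpleGraph V} {u v w : V} (h : IsTriangleOn G u v w) :
    IsTriangleOn G v w u :=
  ⟨h.2.1, h.2.2.symm, h.1.symm⟩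

theorem IsTriangleOn.swap {G : SimpleGraph V} {u v w : V} (h : IsTriangleOn G u v w) :
    IsTriangleOn G v u w :=
  ⟨h.1.symm, h.2.2, h.2.1⟩

theorem triEdges_rotate [DecidableEq V] (u v w : V) : triEdges u v w = triEdges v w u := by
  ext e
  simp only [triEdges, Finset.mem_insert, Finset.mem_singleton, Sym2.eq_swap (a := w) (b := u),
    Sym2.eq_swap (a := v) (b := u)]
  tauto

theorem triEdges_swap [DecidableEq V] (u v w : V) : triEdges u v w = triEdges v u w := by
  ext e
  simp only [triEdges, Finset.mem_insert, Finset.mem_singleton, Sym2.eq_swap (a := v) (b := u)]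
  tauto

/-- A triangle part can be based at any of its edges. -/
theorem IsTrianglePart.exists_apex [DecidableEq V] {G : SimpleGraph V} {P : Finset (Sym2 V)}
    (hP : IsTrianglePart G P) {u v : V} (huv : s(u, v) ∈ P) :
    ∃ t, IsTriangleOn G u v t ∧ P = triEdges u v t := by
  obtain ⟨a, b, c, h, rfl⟩ := hP
  simp only [triEdges, Finset.mem_insert, Finset.mem_singleton, Sym2.eq_iff] at huv
  rcases huv with (⟨rfl, rfl⟩ | ⟨rfl, rfl⟩) | (⟨rfl, rfl⟩ | ⟨rfl, rfl⟩) | (⟨rfl, rfl⟩ | ⟨rfl, rfl⟩)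
  · exact ⟨c, h, rfl⟩
  · exact ⟨c, h.swap, triEdges_swap _ _ _⟩
  · exact ⟨a, h.rotate, triEdges_rotate _ _ _⟩
  · exact ⟨a, h.rotate.swap, by rw [triEdges_rotate, triEdges_swap]⟩
  · exact ⟨b, h.rotate.rotate.swap, by rw [triEdges_rotate, triEdges_rotate, triEdges_swap]⟩
  · exact ⟨b, h.rotate.rotate, by rw [triEdges_rotate, triEdges_rotate]⟩

/-- A triangle part sharing an edge with an isolated triangle is that triangle. -/
theorem IsTrianglePart.eq_of_isIsolatedTriangle [DecidableEq V] {G : SimpleGraph V}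
    {P : Finset (Sym2 V)} (hP : IsTrianglePart G P) {u v w : V} (h : IsIsolatedTriangle G u v w)
    (huv : s(u, v) ∈ P) : P = triEdges u v w := by
  obtain ⟨t, ht, rfl⟩ := hP.exists_apex huv
  by_cases htw : t = w
  · rw [htw]
  · exact absurd ht (h.2 t ht.2.2.ne' ht.2.1.ne' htw).1

/-- In a cubic graph, a claw consists of all the edges at its center. -/
theorem IsClawPart.exists_center [DecidableEq V] {G : SimpleGraph V}
    (hcubic : ∀ v : V, (G.neighborSet v).ncard = 3) {P : Finset (Sym2 V)} (hP : IsClawPart G P) :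
    ∃ c, ∀ e, e ∈ P ↔ e ∈ G.edgeSet ∧ c ∈ e := by
  obtain ⟨c, a, b, d, hab, had, hbd, ha, hb, hd, rfl⟩ := hP
  have hfin : (G.neighborSet c).Finite := Set.finite_of_ncard_ne_zero (by simp [hcubic c])
  have hN : ({a, b, d} : Set V) = G.neighborSet c := by
    refine Set.eq_of_subset_of_ncard_le ?_ ?_ hfin
    · rintro x (rfl | rfl | rfl) <;> assumption
    · rw [hcubic, Set.ncard_eq_three.2 ⟨a, b, d, hab, had, hbd, rfl⟩]
  refine ⟨c, fun e => ⟨fun he => ?_, ?_⟩⟩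
  · simp only [clawEdges, Finset.mem_insert, Finset.mem_singleton] at he
    rcases he with rfl | rfl | rfl <;> simpa
  · rintro ⟨he, hc⟩
    obtain ⟨x, rfl⟩ := Sym2.mem_iff_exists.1 hc
    have hx : x ∈ ({a, b, d} : Set V) := hN ▸ he
    rcases hx with rfl | rfl | rfl <;> simp [clawEdges]

section Decomposition

variable [DecidableEq V] {G : SimpleGraph V} {allowed : Finset (Sym2 V) → Prop}
  {D : Finset (Finset (Sym2 V))}

theorem IsDecompOn.eq_of_mem (hD : IsDecompOn G allowed D) {P Q : Finset (Sym2 V)} (hP : P ∈ D)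
    (hQ : Q ∈ D) {e : Sym2 V} (heP : e ∈ P) (heQ : e ∈ Q) : P = Q := by
  by_contra hne
  exact Finset.disjoint_left.1 (hD.2.1 hP hQ hne) heP heQ

/-- Two adjacent vertices of a triangle are not both centers of claws of a decomposition. -/
theorem IsDecompOn.not_both_centers (hD : IsDecompOn G allowed D) {u v w : V}
    (h : IsTriangleOn G u v w) (hu : ∃ P ∈ D, ∀ e, e ∈ P ↔ e ∈ G.edgeSet ∧ u ∈ e)
    (hv : ∃ P ∈ D, ∀ e, e ∈ P ↔ e ∈ G.edgeSet ∧ v ∈ e) : False := by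
  obtain ⟨P, hP, hPe⟩ := hu
  obtain ⟨Q, hQ, hQe⟩ := hv
  obtain rfl : P = Q := hD.eq_of_mem hP hQ ((hPe s(u, v)).2 ⟨h.1, by simp⟩)
    ((hQe s(u, v)).2 ⟨h.1, by simp⟩)
  have hmem := ((hQe s(u, w)).1 ((hPe s(u, w)).2 ⟨h.2.2, by simp⟩)).2
  rcases Sym2.mem_iff.1 hmem with hvu | hvw
  · exact h.1.ne' hvu
  · exact h.2.1.ne hvw

/-- An edge of an isolated triangle which is not a part of the decomposition has an end that is the
center of a claw. -/
theorem IsDecompOn.center_or_center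
    (hD : IsDecompOn G (fun P => IsClawPart G P ∨ IsTrianglePart G P) D)
    (hcubic : ∀ v : V, (G.neighborSet v).ncard = 3) {u v w : V}
    (h : IsIsolatedTriangle G u v w) (hnot : triEdges u v w ∉ D) :
    (∃ P ∈ D, ∀ e, e ∈ P ↔ e ∈ G.edgeSet ∧ u ∈ e) ∨
      ∃ P ∈ D, ∀ e, e ∈ P ↔ e ∈ G.edgeSet ∧ v ∈ e := by
  obtain ⟨P, hP, he⟩ := (hD.2.2 s(u, v)).1 h.1.1
  rcases hD.1 P hP with hc | ht
  · obtain ⟨c, hc⟩ := hc.exists_center hcubic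
    rcases Sym2.mem_iff.1 ((hc _).1 he).2 with rfl | rfl
    · exact Or.inl ⟨P, hP, hc⟩
    · exact Or.inr ⟨P, hP, hc⟩
  · exact absurd (ht.eq_of_isIsolatedTriangle h he ▸ hP) hnot

theorem IsDecompOn.triEdges_mem
    (hD : IsDecompOn G (fun P => IsClawPart G P ∨ IsTrianglePart G P) D)
    (hcubic : ∀ v : V, (G.neighborSet v).ncard = 3)
    (hiso : ∀ u v w : V, IsTriangleOn G u v w → IsIsolatedTriangle G u v w) {u v w : V}
    (h : IsTriangleOn G u v w) : triEdges u v w ∈ D := by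
  by_contra hnot
  have hnot' : triEdges v w u ∉ D := by rwa [← triEdges_rotate]
  have hnot'' : triEdges w u v ∉ D := by rwa [← triEdges_rotate]
  have huv := hD.center_or_center hcubic (hiso _ _ _ h) hnot
  have hvw := hD.center_or_center hcubic (hiso _ _ _ h.rotate) hnot'
  have hwu := hD.center_or_center hcubic (hiso _ _ _ h.rotate.rotate) hnot''
  have nuv := hD.not_both_centers h
  have nvw := hD.not_both_centers h.rotate
  have nwu := hD.not_both_centers h.rotate.rotate
  rcases huv with hu | hv
  · rcases hvw with hv | hw
    · exact nuv hu hv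
    · exact nwu hw hu
  · rcases hwu with hw | hu
    · exact nvw hv hw
    · exact nuv hu hv

end Decomposition

/-- Let `G` be a connected non-bipartite cubic graph all of whose triangles are
isolated, with a {K₁,₃, K₃}-decomposition `D`, and let `G'` be `G` minus the
edges of all its isolated triangles. Then the parts of `D` are exactly the
isolated triangles together with a partition of the edges of `G'` into claws;
in particular `G` is {K₁,₃, K₃}-decomposable iff `G'` is {K₁,₃}-decomposable. -/
theorem stmt_17 [Fintype V] [DecidableEq V] (G : SimpleGraph V)
    (hconn : G.Connected) (hnb : ¬ G.Colorable 2)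
    (hcubic : ∀ v : V, (G.neighborSet v).ncard = 3)
    (hiso : ∀ u v w : V, IsTriangleOn G u v w → IsIsolatedTriangle G u v w)
    (G' : SimpleGraph V)
    (hG' : G' = G.deleteEdges
      {e : Sym2 V | ∃ u v w : V, IsIsolatedTriangle G u v w ∧ e ∈ triEdges u v w})
    (D : Finset (Finset (Sym2 V)))
    (hD : IsDecompOn G (fun P => IsClawPart G P ∨ IsTrianglePart G P) D) :
    (∀ u v w : V, IsIsolatedTriangle G u v w → triEdges u v w ∈ D) ∧
    (∀ P ∈ D, (∃ u v w : V, IsIsolatedTriangle G u v w ∧ P = triEdges u v w) ∨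
      IsClawPart G' P) ∧
    (∀ e : Sym2 V, e ∈ G'.edgeSet ↔ ∃ P ∈ D, IsClawPart G' P ∧ e ∈ P) ∧
    ((∃ D₀ : Finset (Finset (Sym2 V)),
        IsDecompOn G (fun P => IsClawPart G P ∨ IsTrianglePart G P) D₀) ↔
      ∃ D' : Finset (Finset (Sym2 V)), IsDecompOn G' (IsClawPart G') D') := by
  have htri : ∀ u v w : V, IsIsolatedTriangle G u v w → triEdges u v w ∈ D :=
    fun u v w h => hD.triEdges_mem hcubic hiso h.1
  have hparts : ∀ P ∈ D, (∃ u v w : V, IsIsolatedTriangle G u v w ∧ P = triEdges u v w) ∨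
      IsClawPart G' P := by
    intro P hP
    by_cases hPt : ∃ u v w : V, IsIsolatedTriangle G u v w ∧ P = triEdges u v w
    · exact Or.inl hPt
    right
    have hG'P : ∀ e ∈ P, e ∈ G'.edgeSet := by
      intro e he
      rw [hG', SimpleGraph.edgeSet_deleteEdges]
      refine ⟨(hD.2.2 e).2 ⟨P, hP, he⟩, ?_⟩
      rintro ⟨u, v, w, h, he'⟩
      exact hPt ⟨u, v, w, h, hD.eq_of_mem hP (htri u v w h) he he'⟩
    rcases hD.1 P hP with ⟨c, a, b, d, hab, had, hbd, -, -, -, rfl⟩ | ⟨u, v, w, h, hPe⟩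
    · exact ⟨c, a, b, d, hab, had, hbd, hG'P s(c, a) (by simp [clawEdges]),
        hG'P s(c, b) (by simp [clawEdges]), hG'P s(c, d) (by simp [clawEdges]), rfl⟩
    · exact absurd ⟨u, v, w, hiso u v w h, hPe⟩ hPt
  have hedges : ∀ e : Sym2 V, e ∈ G'.edgeSet ↔ ∃ P ∈ D, IsClawPart G' P ∧ e ∈ P := by
    intro e
    constructor
    · intro he
      have he' := he
      rw [hG', SimpleGraph.edgeSet_deleteEdges] at he'
      obtain ⟨P, hP, heP⟩ := (hD.2.2 e).1 he'.1
      rcases hparts P hP with ⟨u, v, w, h, rfl⟩ | hc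
      · exact absurd ⟨u, v, w, h, heP⟩ he'.2
      · exact ⟨P, hP, hc, heP⟩
    · rintro ⟨P, -, ⟨c, a, b, d, -, -, -, ha, hb, hd, rfl⟩, he⟩
      simp only [clawEdges, Finset.mem_insert, Finset.mem_singleton] at he
      rcases he with rfl | rfl | rfl <;> assumption
  refine ⟨htri, hparts, hedges, fun _ => ?_, fun _ => ⟨D, hD⟩⟩
  classical
  refine ⟨D.filter (IsClawPart G'), fun P hP => (Finset.mem_filter.1 hP).2,
    hD.2.1.subset (Finset.coe_subset.2 (Finset.filter_subset _ _)), fun e => ?_⟩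
  rw [hedges e]
  simp only [Finset.mem_filter, and_assoc]
end
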